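/- arXiv:1401.5927 — 2 statements merged into one kernel-verified Lean document; each statement's English description precedes it below -/
import Mathlib

section
/- Let 𝒯 = (V, E) be a directed tree with no root and branching index Br(𝒯) = 1, and let S_λ be a contractive weighted shift with strictly positive weights on 𝒯. If S_λ is of class C_{1·}, then S_λ has no cyclic vectors. -/
open Filter Topology

/-- `E` is the edge relation of a directed tree on the vertex set `V`:
no loops, every vertex has at most one parent, the underlying undirected graph is
connected (any two distinct vertices are joined by a finite undirected path), and
there is no directed circuit. -/
def IsDirectedTree {V : Type*} (E : V → V → Prop) : Prop :=
  (∀ v, ¬ E v v) ∧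
  (∀ u u' v, E u v → E u' v → u = u') ∧
  (∀ u v : V, Relation.ReflTransGen (fun a b => E a b ∨ E b a) u v) ∧
  (∀ (n : ℕ) (f : Fin (n + 2) → V), Function.Injective f →
    ¬ ((∀ i : Fin (n + 1), E (f i.castSucc) (f i.succ)) ∧ E (f (Fin.last (n + 1))) (f 0)))

/-- The set `Chi(W)` of children of the vertices in `W`; its `n`-th iterate applied to `{u}`
is `Chiⁿ(u)`. -/
def chi {V : Type*} (E : V → V → Prop) (W : Set V) : Set V :=
  {v | ∃ u ∈ W, E u v}

/-- The parent `Par(v)` of a vertex `v` (by convention `v` itself if `v` has no parent). -/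
noncomputable def par {V : Type*} (E : V → V → Prop) (v : V) : V :=
  haveI := Classical.propDecidable (∃ u, E u v)
  if h : ∃ u, E u v then h.choose else v

/-- `Parⁿ(u)` exists, i.e. the whole ancestor chain of length `n` above `u` exists. -/
def parIterExists {V : Type*} (E : V → V → Prop) (n : ℕ) (u : V) : Prop :=
  ∀ j < n, ∃ w, E w ((par E)^[j] u)

/-- The level (whole generation) `Gen(u) = ⋃_j Chi^j(Par^j(u))` of a vertex `u`. -/
def gen {V : Type*} (E : V → V → Prop) (u : V) : Set V :=
  ⋃ j : ℕ, (chi E)^[j] {(par E)^[j] u}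

/-- The standard orthonormal basis vector `e_u` of `ℓ²(V)`. -/
noncomputable def evec {V : Type*} (u : V) : lp (fun _ : V => ℂ) 2 :=
  haveI := Classical.decEq V
  lp.single 2 u 1

/-- `f` is a cyclic vector for the bounded linear operator `T`: the closed linear span of the
orbit `{Tⁿ f : n ∈ ℤ₊}` is the whole space. -/
def IsCyclicVector {H : Type*} [NormedAddCommGroup H] [NormedSpace ℂ H]
    (T : H →L[ℂ] H) (f : H) : Prop :=
  (Submodule.span ℂ (Set.range fun n : ℕ => (T ^ n) f)).topologicalClosure = ⊤

/-- A continuous functional vanishing on the orbit of a cyclic vector is zero. -/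
theorem IsCyclicVector.functional_eq_zero {H : Type*} [NormedAddCommGroup H] [NormedSpace ℂ H]
    {T : H →L[ℂ] H} {f : H} (hf : IsCyclicVector T f) (φ : H →L[ℂ] ℂ)
    (hφ : ∀ n : ℕ, φ ((T ^ n) f) = 0) (x : H) : φ x = 0 := by
  have hle : (Submodule.span ℂ (Set.range fun n : ℕ => (T ^ n) f)).topologicalClosure ≤
      LinearMap.ker (φ : H →ₗ[ℂ] ℂ) := by
    refine Submodule.topologicalClosure_minimal _ ?_ φ.isClosed_ker
    rw [Submodule.span_le]
    rintro _ ⟨n, rfl⟩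
    exact hφ n
  have hx : x ∈ (Submodule.span ℂ (Set.range fun n : ℕ => (T ^ n) f)).topologicalClosure := by
    rw [show _ = ⊤ from hf]
    trivial
  exact hle hx

theorem evec_apply_self {V : Type*} (u : V) : (evec u : V → ℂ) u = 1 := by
  classical
  simp [evec]

theorem evec_apply_of_ne {V : Type*} {u v : V} (h : v ≠ u) : (evec u : V → ℂ) v = 0 := by
  classical
  simp [evec, h]

theorem norm_evec {V : Type*} (u : V) : ‖(evec u : lp (fun _ : V => ℂ) 2)‖ = 1 := by
  classical
  simp [evec, lp.norm_single]

theorem hasSum_smul_evec {V : Type*} (x : lp (fun _ : V => ℂ) 2) :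
    HasSum (fun u => x u • evec u) x := by
  classical
  convert lp.hasSum_single (by norm_num) x using 2 with u
  ext v
  by_cases h : v = u
  · subst h
    simp [evec_apply_self]
  · simp [evec_apply_of_ne h, h]

/-- Composition with an injective map followed by multiplication by a bounded sequence, as a
bounded operator between `ℓ²` spaces. -/
theorem exists_weighted_pullback {V W : Type*} {p : W → V} (hp : Function.Injective p)
    {c : W → ℂ} {C : ℝ} (hc : ∀ k, ‖c k‖ ≤ C) :
    ∃ A : lp (fun _ : V => ℂ) 2 →L[ℂ] lp (fun _ : W => ℂ) 2,
      ∀ x k, A x k = c k * x (p k) := by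
  have hbound : ∀ (x : lp (fun _ : V => ℂ) 2) (s : Finset W),
      ∑ k ∈ s, ‖c k * x (p k)‖ ^ (2 : ENNReal).toReal ≤
        ((max C 0) * ‖x‖) ^ (2 : ENNReal).toReal := by
    intro x s
    have h1 := lp.sum_rpow_le_norm_rpow (p := 2) (by norm_num) x (s.map ⟨p, hp⟩)
    simp only [ENNReal.toReal_ofNat, Real.rpow_ofNat, Finset.sum_map,
      Function.Embedding.coeFn_mk] at h1 ⊢
    calc ∑ k ∈ s, ‖c k * x (p k)‖ ^ 2
        ≤ ∑ k ∈ s, (max C 0) ^ 2 * ‖x (p k)‖ ^ 2 := by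
          refine Finset.sum_le_sum fun k _ => ?_
          rw [norm_mul, mul_pow]
          gcongr
          exact (hc k).trans (le_max_left _ _)
      _ ≤ (max C 0 * ‖x‖) ^ 2 := by
          rw [← Finset.mul_sum, mul_pow]
          gcongr
  have hmem : ∀ x : lp (fun _ : V => ℂ) 2, Memℓp (fun k => c k * x (p k)) 2 :=
    fun x => memℓp_gen' (hbound x)
  refine ⟨LinearMap.mkContinuous
    { toFun := fun x => ⟨fun k => c k * x (p k), hmem x⟩
      map_add' := fun x y => ?_
      map_smul' := fun a x => ?_ } (max C 0) fun x => ?_, fun x k => rfl⟩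
  · ext k
    exact mul_add _ _ _
  · ext k
    exact mul_left_comm _ _ _
  · exact lp.norm_le_of_forall_sum_le (by norm_num) (by positivity) (hbound x)

/-- Each coefficient of the convolution with a fixed square summable sequence is a bounded
functional on `ℓ²(ℤ)`. -/
theorem exists_convolution_functional (z : lp (fun _ : ℤ => ℂ) 2) (n : ℤ) :
    ∃ φ : lp (fun _ : ℤ => ℂ) 2 →L[ℂ] ℂ, ∀ y, φ y = ∑' k, y k * z (n - k) := by
  obtain ⟨R, hR⟩ := exists_weighted_pullback (p := fun k : ℤ => n - k) (c := fun _ => 1) (C := 1)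
    (sub_right_injective) (by simp)
  refine ⟨innerSL ℂ (star (R z)), fun y => ?_⟩
  rw [innerSL_apply_apply, lp.inner_eq_tsum]
  refine tsum_congr fun k => ?_
  simp [hR]

theorem exists_weight_sequence (μ : ℤ → ℝ) (hμ : ∀ k, 0 < μ k) :
    ∃ c : ℤ → ℝ, (∀ k, 0 < c k) ∧ c 0 = 1 ∧ ∀ k, c k * μ k = c (k - 1) := by
  refine ⟨fun k => (∏ j ∈ Finset.range k.toNat, μ (j + 1))⁻¹ *
    ∏ j ∈ Finset.range (-k).toNat, μ (-j), fun k => ?_, by simp, fun k => ?_⟩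
  · exact mul_pos (inv_pos.2 (Finset.prod_pos fun _ _ => hμ _)) (Finset.prod_pos fun _ _ => hμ _)
  · rcases le_or_gt k 0 with hk | hk
    · obtain ⟨n, rfl⟩ : ∃ n : ℕ, k = -n := ⟨(-k).toNat, by omega⟩
      have h1 : (-(n : ℤ)).toNat = 0 := by omega
      have h2 : (-(n : ℤ) - 1).toNat = 0 := by omega
      have h3 : (-(-(n : ℤ))).toNat = n := by omega
      have h4 : (-(-(n : ℤ) - 1)).toNat = n + 1 := by omega
      simp only [h1, h2, h3, h4, Finset.prod_range_succ]
      ring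
    · obtain ⟨n, rfl⟩ : ∃ n : ℕ, k = n + 1 := ⟨(k - 1).toNat, by omega⟩
      have h1 : ((n : ℤ) + 1).toNat = n + 1 := by omega
      have h2 : ((n : ℤ) + 1 - 1).toNat = n := by omega
      have h3 : (-((n : ℤ) + 1)).toNat = 0 := by omega
      have h4 : (-((n : ℤ) + 1 - 1)).toNat = 0 := by omega
      simp only [h1, h2, h3, h4, Finset.prod_range_succ]
      have := (hμ (n + 1)).ne'
      field_simp

/-- In a rootless leafless relation, every edge lies on a two-sided infinite path. -/
theorem exists_biinfinite_path {V : Type*} {E : V → V → Prop} (hroot : ∀ v, ∃ u, E u v)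
    (hleaf : ∀ u, ∃ v, E u v) {u v : V} (huv : E u v) :
    ∃ p : ℤ → V, p 0 = u ∧ p 1 = v ∧ ∀ k, E (p k) (p (k + 1)) := by
  choose pr hpr using hroot
  choose ch hch using hleaf
  refine ⟨fun k => if 1 ≤ k then ch^[(k - 1).toNat] v else pr^[(-k).toNat] u, by simp, by simp,
    fun k => ?_⟩
  rcases lt_trichotomy k 0 with hk | rfl | hk
  · have h : (-k).toNat = (-(k + 1)).toNat + 1 := by omega
    simp only [show ¬ 1 ≤ k by omega, show ¬ 1 ≤ k + 1 by omega, if_false, h,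
      Function.iterate_succ_apply']
    exact hpr _
  · simpa using huv
  · have h : (k + 1 - 1).toNat = (k - 1).toNat + 1 := by omega
    simp only [show 1 ≤ k by omega, show 1 ≤ k + 1 by omega, if_true, h,
      Function.iterate_succ_apply']
    exact hch _

theorem IsDirectedTree.path_injective {V : Type*} {E : V → V → Prop} (hE : IsDirectedTree E)
    {p : ℤ → V} (hp : ∀ k, E (p k) (p (k + 1))) : Function.Injective p := by
  classical
  have key : ∀ d : ℕ, ∀ i : ℤ, p i ≠ p (i + (d + 1 : ℕ)) := by
    intro d
    induction d using Nat.strong_induction_on with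
    | _ d ih =>
      intro i hi
      rcases d with _ | n
      · have h := hp i
        rw [hi] at h
        exact hE.1 _ (by simpa using h)
      · refine hE.2.2.2 n (fun t => p (i + (t : ℕ))) ?_ ⟨fun t => ?_, ?_⟩
        · have hlt : ∀ s t : Fin (n + 2), s < t → p (i + (s : ℕ)) ≠ p (i + (t : ℕ)) := by
            intro s t hst
            have h := ih ((t : ℕ) - s - 1) (by omega) (i + (s : ℕ))
            rwa [show i + (s : ℕ) + (((t : ℕ) - s - 1 + 1 : ℕ) : ℤ) = i + (t : ℕ) by omega] at h
          intro s t hst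
          rcases lt_trichotomy s t with h | h | h
          · exact absurd hst (hlt s t h)
          · exact h
          · exact absurd hst.symm (hlt t s h)
        · have h := hp (i + (t : ℕ))
          simpa [add_assoc] using h
        · have h := hp (i + ((n + 1 : ℕ) : ℤ))
          simp only [Fin.val_last, Fin.val_zero, Nat.cast_zero, add_zero]
          rw [hi]
          convert h using 2
          push_cast
          ring
  intro i j hij
  by_contra hne
  rcases lt_or_gt_of_ne hne with h | h
  · exact key (j - i - 1).toNat i
      (by rw [hij]; congr 1; omega)
  · exact key (i - j - 1).toNat j
      (by rw [← hij]; congr 1; omega)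

section WeightedShift

variable {V : Type*} {E : V → V → Prop} {lam : V → ℝ}
  {S : lp (fun _ : V => ℂ) 2 →L[ℂ] lp (fun _ : V => ℂ) 2}

theorem weightedShift_apply (hpar : ∀ u u' v, E u v → E u' v → u = u')
    (hS : ∀ u v : V, (S (evec u)) v = Set.indicator {w | E u w} (fun w => (lam w : ℂ)) v)
    {u v : V} (huv : E u v) (x : lp (fun _ : V => ℂ) 2) : (S x) v = lam v * x u := by
  have h1 := ((lp.evalCLM ℂ (fun _ : V => ℂ) 2 v).comp S).hasSum (hasSum_smul_evec x)
  have h2 : ∀ u', u' ≠ u →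
      ((lp.evalCLM ℂ (fun _ : V => ℂ) 2 v).comp S) (x u' • evec u') = 0 := by
    intro u' hu'
    have : ¬ E u' v := fun h => hu' (hpar _ _ _ h huv)
    rw [map_smul, ContinuousLinearMap.comp_apply]
    change x u' • (S (evec u')) v = 0
    simp [hS, this]
  refine (h1.unique (hasSum_single u h2)).trans ?_
  rw [map_smul, ContinuousLinearMap.comp_apply]
  change x u • (S (evec u)) v = _
  simp [hS, huv, mul_comm]

theorem weightedShift_evec
    (hS : ∀ u v : V, (S (evec u)) v = Set.indicator {w | E u w} (fun w => (lam w : ℂ)) v)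
    {u v : V} (huv : E u v) (hu : {w | E u w}.Subsingleton) :
    S (evec u) = (lam v : ℂ) • evec v := by
  ext w
  rw [hS, lp.coeFn_smul, Pi.smul_apply, smul_eq_mul]
  by_cases hw : w = v
  · subst hw
    simp [huv, evec_apply_self]
  · have : ¬ E u w := fun h => hw (hu h huv)
    simp [this, evec_apply_of_ne hw]

theorem weightedShift_exists_child
    (hS : ∀ u v : V, (S (evec u)) v = Set.indicator {w | E u w} (fun w => (lam w : ℂ)) v)
    (hC1 : ∀ x : lp (fun _ : V => ℂ) 2,
      Tendsto (fun n : ℕ => ‖(S ^ n) x‖) atTop (𝓝 0) → x = 0) (u : V) : ∃ v, E u v := by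
  by_contra! h
  have h0 : S (evec u) = 0 := by
    ext v
    simp [hS, h]
  have h1 : (evec u : lp (fun _ : V => ℂ) 2) = 0 := by
    refine hC1 _ (tendsto_const_nhds.congr' ?_)
    filter_upwards [eventually_ge_atTop 1] with n hn
    obtain ⟨m, rfl⟩ := Nat.exists_eq_add_of_le' hn
    simp [pow_succ, h0]
  simpa [h1] using norm_evec u

theorem weightedShift_weight_le_one
    (hS : ∀ u v : V, (S (evec u)) v = Set.indicator {w | E u w} (fun w => (lam w : ℂ)) v)
    (hcon : ‖S‖ ≤ 1) {u v : V} (huv : E u v) : lam v ≤ 1 := by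
  have h1 := lp.norm_apply_le_norm (p := 2) (by norm_num) (S (evec u)) v
  have h2 := S.le_of_opNorm_le hcon (evec u)
  rw [norm_evec] at h2
  simp only [hS, Set.mem_ofPred_eq, huv, Set.indicator_of_mem, Complex.norm_real] at h1
  exact (Real.le_norm_self _).trans (h1.trans (by simpa using h2))

/-- The orbit of a vector under a contraction is bounded below in norm unless it tends to zero. -/
theorem exists_pos_le_norm_pow {H : Type*} [NormedAddCommGroup H] [NormedSpace ℂ H]
    {T : H →L[ℂ] H} (hT : ‖T‖ ≤ 1) {x : H}
    (hx : ¬ Tendsto (fun n : ℕ => ‖(T ^ n) x‖) atTop (𝓝 0)) :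
    ∃ ε > 0, ∀ n : ℕ, ε ≤ ‖(T ^ n) x‖ := by
  have hanti : Antitone fun n : ℕ => ‖(T ^ n) x‖ := by
    refine antitone_nat_of_succ_le fun n => ?_
    rw [pow_succ']
    simpa using T.le_of_opNorm_le hT ((T ^ n) x)
  have hbdd : BddBelow (Set.range fun n : ℕ => ‖(T ^ n) x‖) :=
    ⟨0, by rintro _ ⟨n, rfl⟩; exact norm_nonneg _⟩
  have hlim := tendsto_atTop_ciInf hanti hbdd
  refine ⟨_, (Real.iInf_nonneg fun n => norm_nonneg _).lt_of_ne fun h => hx ?_,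
    fun n => ciInf_le hbdd n⟩
  rwa [← h] at hlim

/-- A weighted shift intertwines, along a path that branches only at its vertex `0`, with the
bilateral shift on `ℓ²(ℤ)`. -/
theorem weightedShift_exists_intertwining (hE : IsDirectedTree E) (hlam : ∀ v, 0 < lam v)
    (hS : ∀ u v : V, (S (evec u)) v = Set.indicator {w | E u w} (fun w => (lam w : ℂ)) v)
    (hcon : ‖S‖ ≤ 1)
    (hC1 : ∀ x : lp (fun _ : V => ℂ) 2,
      Tendsto (fun n : ℕ => ‖(S ^ n) x‖) atTop (𝓝 0) → x = 0)
    {p : ℤ → V} (hp : ∀ k, E (p k) (p (k + 1)))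
    (hone : ∀ u, u ≠ p 0 → {v | E u v}.Subsingleton) :
    ∃ (c : ℤ → ℂ) (A : lp (fun _ : V => ℂ) 2 →L[ℂ] lp (fun _ : ℤ => ℂ) 2),
      (∀ k, c k ≠ 0) ∧ (∀ x k, A x k = c k * x (p k)) ∧
      ∀ (m : ℕ) x k, A ((S ^ m) x) k = A x (k - m) := by
  have hinj := hE.path_injective hp
  obtain ⟨c, hcpos, hc0, hc⟩ := exists_weight_sequence (fun k => lam (p k)) fun k => hlam _
  have hneg : ∀ n : ℕ, c (-n) ≤ 1 := by
    intro n
    induction n with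
    | zero => simp [hc0]
    | succ n ih =>
      have h := hp (-(n : ℤ) - 1)
      rw [sub_add_cancel] at h
      rw [show (-((n + 1 : ℕ) : ℤ)) = -(n : ℤ) - 1 by push_cast; ring, ← hc]
      exact mul_le_one₀ ih (hlam _).le (weightedShift_weight_le_one hS hcon h)
  have hpow : ∀ n : ℕ, (S ^ n) (evec (p 1)) = ((c 1 / c (n + 1) : ℝ) : ℂ) • evec (p (n + 1)) := by
    intro n
    induction n with
    | zero => simp [(hcpos 1).ne']
    | succ n ih =>
      have hne : p (n + 1) ≠ p 0 := fun h => by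
        have := hinj h
        omega
      have h1 := hc (n + 1 + 1)
      rw [add_sub_cancel_right] at h1
      rw [pow_succ', mul_apply_eq_comp, ih, map_smul,
        weightedShift_evec hS (hp (n + 1)) (hone _ hne), smul_smul, ← Complex.ofReal_mul]
      have := (hcpos (n + 1 + 1)).ne'
      have := (hlam (p (n + 1 + 1))).ne'
      rw [Nat.cast_succ]
      rw [← h1]
      congr 2
      field_simp
  obtain ⟨ε, hε, hle⟩ := exists_pos_le_norm_pow hcon (x := evec (p 1)) fun h => by
    have h1 := norm_evec (p 1)
    simp [hC1 _ h] at h1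
  have hbound : ∀ k, ‖(c k : ℂ)‖ ≤ max 1 (c 1 / ε) := by
    intro k
    rw [Complex.norm_real, Real.norm_of_nonneg (hcpos k).le]
    rcases le_or_gt k 0 with hk | hk
    · obtain ⟨n, rfl⟩ : ∃ n : ℕ, k = -n := ⟨(-k).toNat, by omega⟩
      exact (hneg n).trans (le_max_left _ _)
    · obtain ⟨n, rfl⟩ : ∃ n : ℕ, k = n + 1 := ⟨(k - 1).toNat, by omega⟩
      refine le_trans ?_ (le_max_right _ _)
      have h := hle n
      rw [hpow, norm_smul, norm_evec, mul_one, Complex.norm_real,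
        Real.norm_of_nonneg (div_pos (hcpos _) (hcpos _)).le] at h
      exact (le_div_comm₀ hε (hcpos _)).1 h
  obtain ⟨A, hA⟩ := exists_weighted_pullback hinj hbound
  refine ⟨fun k => c k, A, fun k => Complex.ofReal_ne_zero.2 (hcpos k).ne', hA, fun m => ?_⟩
  induction m with
  | zero => simp
  | succ m ih =>
    intro x k
    have h := hp (k - m - 1)
    rw [sub_add_cancel] at h
    rw [pow_succ, mul_apply_eq_comp, ih, hA, hA,
      weightedShift_apply hE.2.1 hS h, ← mul_assoc, ← Complex.ofReal_mul, hc]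
    congr 3 <;> (push_cast; ring_nf)

end WeightedShift

/-- If a directed tree has no root and branching index `1`, then a contractive weighted shift
on it of class `C_{1·}` has no cyclic vectors. -/
theorem stmt_17 {V : Type*} (E : V → V → Prop) (hE : IsDirectedTree E)
    (hrootless : ∀ v : V, ∃ u, E u v)
    (hBr : ∃ u₀ : V, {v | E u₀ v}.ncard = 2 ∧ ∀ u, u ≠ u₀ → {v | E u v}.Subsingleton)
    (lam : V → ℝ) (hlam : ∀ v, 0 < lam v)
    (S : lp (fun _ : V => ℂ) 2 →L[ℂ] lp (fun _ : V => ℂ) 2)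
    (hS : ∀ u v : V, (S (evec u)) v = Set.indicator {w | E u w} (fun w => (lam w : ℂ)) v)
    (hcon : ‖S‖ ≤ 1)
    (hC1 : ∀ x : lp (fun _ : V => ℂ) 2,
      Tendsto (fun n : ℕ => ‖(S ^ n) x‖) atTop (𝓝 0) → x = 0) :
    ¬ ∃ f, IsCyclicVector S f := by
  rintro ⟨f, hf⟩
  obtain ⟨u₀, hcard, hone⟩ := hBr
  obtain ⟨v, w, hvw, hchi⟩ := Set.ncard_eq_two.1 hcard
  have hv : E u₀ v := by
    change v ∈ {v | E u₀ v}
    simp [hchi]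
  have hw : E u₀ w := by
    change w ∈ {v | E u₀ v}
    simp [hchi]
  have hleaf := weightedShift_exists_child hS hC1
  obtain ⟨p, hp0, hp1, hp⟩ := exists_biinfinite_path hrootless hleaf hv
  obtain ⟨q, hq0, hq1, hq⟩ := exists_biinfinite_path hrootless hleaf hw
  obtain ⟨c, A, hc, hA, hAS⟩ :=
    weightedShift_exists_intertwining hE hlam hS hcon hC1 hp (by rwa [hp0])
  obtain ⟨d, B, hd, hB, hBS⟩ :=
    weightedShift_exists_intertwining hE hlam hS hcon hC1 hq (by rwa [hq0])
  have hinjp := hE.path_injective hp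
  have hinjq := hE.path_injective hq
  have hqv : ∀ k, q k ≠ p 1 := by
    intro k hk
    have h := hq (k - 1)
    rw [sub_add_cancel, hk, hp1] at h
    have h1 : q (k - 1) = q 0 := by rw [hq0, hE.2.1 _ _ _ h hv]
    have h2 : k = 1 := by linarith [hinjq h1]
    rw [h2, hq1, hp1] at hk
    exact hvw hk.symm
  have hBe : B (evec (p 1)) = 0 := by
    ext k
    simp [hB, evec_apply_of_ne (hqv k)]
  have hBf : ∀ n, B f n = 0 := by
    intro n
    obtain ⟨φ, hφ⟩ := exists_convolution_functional (B f) (n + 1)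
    obtain ⟨ψ, hψ⟩ := exists_convolution_functional (A f) (n + 1)
    have h := hf.functional_eq_zero (φ.comp A - ψ.comp B) (fun m => ?_) (evec (p 1))
    · rw [sub_apply, ContinuousLinearMap.comp_apply,
        ContinuousLinearMap.comp_apply, hBe, map_zero, sub_zero, hφ, tsum_eq_single 1] at h
      · simpa [hA, evec_apply_self, hc] using h
      · intro k hk
        rw [hA, evec_apply_of_ne fun h => hk (hinjp h), mul_zero, zero_mul]
    · rw [sub_apply, ContinuousLinearMap.comp_apply,
        ContinuousLinearMap.comp_apply, hφ, hψ, sub_eq_zero,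
        ← (Equiv.subLeft (n + 1 + m)).tsum_eq]
      refine tsum_congr fun k => ?_
      rw [hAS, hBS, Equiv.subLeft_apply, mul_comm]
      rw [show n + 1 + m - k - m = n + 1 - k by ring, show n + 1 - (n + 1 + m - k) = k - m by ring]
  have h := hf.functional_eq_zero ((lp.evalCLM ℂ (fun _ : ℤ => ℂ) 2 0).comp B)
    (fun m => (hBS m f 0).trans (hBf _)) (evec (q 0))
  have h1 : B (evec (q 0)) 0 = 0 := h
  rw [hB, evec_apply_self, mul_one] at h1
  exact hd 0 h1
end

section
/- For every k ∈ ℕ, the operator S ⊕ (S⁺_k)* is cyclic, where S is the simple bilateral shift on ℓ²(ℤ) (S e_n = e_{n+1}), S⁺ is the simple unilateral shift on ℓ²(ℤ₊) (S⁺ e_j = e_{j+1}), S⁺_k denotes the orthogonal direct sum of k copies of S⁺, and (S⁺_k)* is its adjoint (the k-fold direct sum of the backward shift) acting on the k-fold direct sum of ℓ²(ℤ₊). -/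
open Filter Topology

open Polynomial in
theorem aeval_mem_closure_span_orbit {H : Type*} [NormedAddCommGroup H] [NormedSpace ℂ H]
    (T : H →L[ℂ] H) (f : H) (q : ℂ[X]) :
    aeval T q f ∈ (Submodule.span ℂ (Set.range fun n : ℕ => (T ^ n) f)).topologicalClosure := by
  apply Submodule.le_topologicalClosure
  rw [aeval_eq_sum_range, sum_apply]
  exact Submodule.sum_mem _ fun i _ => Submodule.smul_mem _ _ (Submodule.subset_span ⟨i, rfl⟩)

theorem map_mem_closure_span_orbit {H : Type*} [NormedAddCommGroup H] [NormedSpace ℂ H]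
    (T : H →L[ℂ] H) {f x : H}
    (hx : x ∈ (Submodule.span ℂ (Set.range fun n : ℕ => (T ^ n) f)).topologicalClosure) :
    T x ∈ (Submodule.span ℂ (Set.range fun n : ℕ => (T ^ n) f)).topologicalClosure := by
  refine map_mem_closure T.continuous hx fun y hy => ?_
  change T.toLinearMap y ∈ Submodule.span ℂ (Set.range fun n : ℕ => (T ^ n) f)
  rw [← Submodule.mem_comap]
  refine (Submodule.span_le.2 ?_) hy
  rintro _ ⟨n, rfl⟩
  refine Submodule.subset_span ⟨n + 1, ?_⟩
  simp [pow_succ']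

open Polynomial in
theorem exists_aeval_of_mem_span_orbit {H : Type*} [NormedAddCommGroup H] [NormedSpace ℂ H]
    (T : H →L[ℂ] H) {f x : H}
    (hx : x ∈ Submodule.span ℂ (Set.range fun n : ℕ => (T ^ n) f)) :
    ∃ q : ℂ[X], aeval T q f = x := by
  induction hx using Submodule.span_induction with
  | mem x h =>
    obtain ⟨n, rfl⟩ := h
    exact ⟨X ^ n, by simp⟩
  | zero => exact ⟨0, by simp⟩
  | add x y _ _ hx hy =>
    obtain ⟨p, rfl⟩ := hx
    obtain ⟨q, rfl⟩ := hy
    exact ⟨p + q, by simp⟩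
  | smul a x _ hx =>
    obtain ⟨p, rfl⟩ := hx
    exact ⟨a • p, by simp⟩

section BackwardShift

variable {H ι : Type*} [NormedAddCommGroup H] [NormedSpace ℂ H] {T : H →L[ℂ] H} {e : ι → ℕ → H}

theorem span_lt_mono (e : ι → ℕ → H) {m n : ℕ} (hmn : m ≤ n) :
    Submodule.span ℂ {x | ∃ j, ∃ i < m, e j i = x} ≤
      Submodule.span ℂ {x | ∃ j, ∃ i < n, e j i = x} :=
  Submodule.span_mono fun _ ⟨j, i, hi, hx⟩ => ⟨j, i, hi.trans_le hmn, hx⟩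

theorem exists_mem_span_lt_of_mem_span {x : H}
    (hx : x ∈ Submodule.span ℂ (Set.range fun p : ι × ℕ => e p.1 p.2)) :
    ∃ n, x ∈ Submodule.span ℂ {x | ∃ j, ∃ i < n, e j i = x} := by
  induction hx using Submodule.span_induction with
  | mem x h =>
    obtain ⟨⟨j, i⟩, rfl⟩ := h
    exact ⟨i + 1, Submodule.subset_span ⟨j, i, i.lt_succ_self, rfl⟩⟩
  | zero => exact ⟨0, Submodule.zero_mem _⟩
  | add x y _ _ hx hy =>
    obtain ⟨m, hm⟩ := hx
    obtain ⟨n, hn⟩ := hy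
    exact ⟨max m n, Submodule.add_mem _ (span_lt_mono e (le_max_left _ _) hm)
      (span_lt_mono e (le_max_right _ _) hn)⟩
  | smul a x _ hx =>
    obtain ⟨m, hm⟩ := hx
    exact ⟨m, Submodule.smul_mem _ _ hm⟩

theorem map_mem_span_lt (h0 : ∀ j, T (e j 0) = 0) (hs : ∀ j m, T (e j (m + 1)) = e j m)
    {m : ℕ} {x : H} (hx : x ∈ Submodule.span ℂ {x | ∃ j, ∃ i < m + 1, e j i = x}) :
    T x ∈ Submodule.span ℂ {x | ∃ j, ∃ i < m, e j i = x} := by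
  change T.toLinearMap x ∈ _
  rw [← Submodule.mem_comap]
  refine (Submodule.span_le.2 ?_) hx
  rintro _ ⟨j, i, hi, rfl⟩
  cases i with
  | zero => simp [h0]
  | succ i =>
    refine Submodule.subset_span ⟨j, i, Nat.lt_of_succ_lt_succ hi, ?_⟩
    simp [hs]

theorem pow_apply_eq_zero_of_mem_span_lt (h0 : ∀ j, T (e j 0) = 0)
    (hs : ∀ j m, T (e j (m + 1)) = e j m) {n : ℕ} {x : H}
    (hx : x ∈ Submodule.span ℂ {x | ∃ j, ∃ i < n, e j i = x}) : (T ^ n) x = 0 := by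
  induction n generalizing x with
  | zero => simpa using hx
  | succ n ih => simpa [pow_succ] using ih (map_mem_span_lt h0 hs hx)

theorem pow_apply_add (hs : ∀ j m, T (e j (m + 1)) = e j m) (j : ι) (n m : ℕ) :
    (T ^ n) (e j (n + m)) = e j m := by
  induction n with
  | zero => simp
  | succ n ih => rw [pow_succ, mul_apply_eq_comp, Nat.add_right_comm, hs, ih]

open Polynomial in
theorem aeval_mem_span_lt (h0 : ∀ j, T (e j 0) = 0) (hs : ∀ j m, T (e j (m + 1)) = e j m)
    {m : ℕ} {x : H} (hx : x ∈ Submodule.span ℂ {x | ∃ j, ∃ i < m, e j i = x}) (q : ℂ[X]) :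
    aeval T q x ∈ Submodule.span ℂ {x | ∃ j, ∃ i < m, e j i = x} := by
  have hpow : ∀ n : ℕ, (T ^ n) x ∈ Submodule.span ℂ {x | ∃ j, ∃ i < m, e j i = x} := by
    intro n
    induction n with
    | zero => simpa using hx
    | succ n ih =>
      rw [pow_succ', mul_apply_eq_comp]
      exact map_mem_span_lt h0 hs (span_lt_mono e m.le_succ ih)
  rw [aeval_eq_sum_range, sum_apply]
  exact Submodule.sum_mem _ fun i _ => Submodule.smul_mem _ _ (hpow i)

open Polynomial in
/-- If `w` is a limit of vectors `-T q(T) w` and `T` does not increase norms along the orbit of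
`w`, then `w` together with countably many backward shift orbits is generated by one vector. -/
theorem exists_closure_span_orbit_backward [CompleteSpace H] [Countable ι]
    (h0 : ∀ j, T (e j 0) = 0) (hs : ∀ j m, T (e j (m + 1)) = e j m)
    (hnorm : ∀ j m, ‖e j m‖ ≤ 1) (w : H)
    (hw : ∀ ε > 0, ∃ q : ℂ[X], ‖w + aeval T q (T w)‖ < ε)
    (hiso : ∀ (n : ℕ) (q : ℂ[X]), ‖(T ^ n) (aeval T q w)‖ ≤ ‖aeval T q w‖) :
    ∃ f, w ∈ (Submodule.span ℂ (Set.range fun n : ℕ => (T ^ n) f)).topologicalClosure ∧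
      ∀ j m, e j m ∈ (Submodule.span ℂ (Set.range fun n : ℕ => (T ^ n) f)).topologicalClosure := by
  set Y : ℕ → Submodule ℂ H := fun m => Submodule.span ℂ {x | ∃ j, ∃ i < m, e j i = x} with hY
  set W : Submodule ℂ H :=
    (Submodule.span ℂ (Set.range fun p : ι × ℕ => e p.1 p.2)).topologicalClosure with hW
  have heW : ∀ j m, e j m ∈ W := fun j m =>
    Submodule.le_topologicalClosure _ (Submodule.subset_span ⟨(j, m), rfl⟩)
  have hYW : ∀ m, Y m ≤ W := fun m => Submodule.span_le.2 fun _ ⟨j, i, _, h⟩ => h ▸ heW j i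
  let O : ι × ℕ × ℕ → Set W := fun a =>
    ⋃ (q : ℂ[X]), ⋃ y ∈ Y a.2.1,
      {u : W | ‖aeval T q (w + u) - e a.1 a.2.1 - y‖ < 1 / ((a.2.2 : ℝ) + 1)}
  have hO : ∀ a, IsOpen (O a) := fun a =>
    isOpen_iUnion fun q => isOpen_biUnion fun y _ =>
      isOpen_lt (by fun_prop) continuous_const
  have hD : ∀ a, Dense (O a) := by
    rintro ⟨j, m, N⟩
    refine Metric.dense_iff.2 fun u δ hδ => ?_
    obtain ⟨v, hv, huv⟩ := Metric.mem_closure_iff.1 u.2 (δ / 2) (by positivity)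
    obtain ⟨n, hn⟩ := exists_mem_span_lt_of_mem_span hv
    set C : ℝ := 4 / δ with hC
    have hC0 : 0 < C := by positivity
    obtain ⟨q, hq⟩ := hw (1 / ((N : ℝ) + 1) / C) (by positivity)
    set x : H := v + (C : ℂ)⁻¹ • e j (n + m) with hx
    have hxW : x ∈ W :=
      W.add_mem (Submodule.le_topologicalClosure _ hv) (W.smul_mem _ (heW _ _))
    refine ⟨⟨x, hxW⟩, ?_, ?_⟩
    · rw [Metric.mem_ball, dist_comm, Subtype.dist_eq]
      change dist (u : H) x < δ
      have h1 : dist v x ≤ δ / 4 := by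
        rw [dist_eq_norm, hx, sub_add_cancel_left, norm_neg, norm_smul, norm_inv,
          Complex.norm_real, Real.norm_of_nonneg hC0.le, hC, inv_div]
        exact mul_le_of_le_one_right (by positivity) (hnorm _ _)
      linarith [dist_triangle (u : H) v x]
    · simp only [O, Set.mem_iUnion, Set.mem_ofPred_eq]
      refine ⟨Polynomial.C (C : ℂ) * (1 + q * X) * X ^ n, aeval T q (T (e j m)), ?_, ?_⟩
      · refine aeval_mem_span_lt h0 hs (map_mem_span_lt h0 hs ?_) q
        exact Submodule.subset_span ⟨j, m, m.lt_succ_self, rfl⟩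
      · have hxn : (T ^ n) x = (C : ℂ)⁻¹ • e j m := by
          rw [hx, map_add, pow_apply_eq_zero_of_mem_span_lt h0 hs hn, map_smul,
            pow_apply_add hs, zero_add]
        have hcomm : aeval T ((1 + q * X) * X ^ n) w = (T ^ n) (aeval T (1 + q * X) w) := by
          rw [mul_comm, map_mul, map_pow, aeval_X, mul_apply_eq_comp]
        have hwq : aeval T (1 + q * X) w = w + aeval T q (T w) := by simp
        have key : aeval T (Polynomial.C (C : ℂ) * (1 + q * X) * X ^ n) (w + x) - e j m
            - aeval T q (T (e j m)) = (C : ℂ) • (T ^ n) (aeval T (1 + q * X) w) := by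
          have hCx : aeval T (Polynomial.C (C : ℂ) * (1 + q * X) * X ^ n) x
              = e j m + aeval T q (T (e j m)) := by
            have hCC : (C : ℂ) ≠ 0 := by exact_mod_cast hC0.ne'
            rw [map_mul, map_pow, aeval_X, mul_apply_eq_comp, hxn, map_smul,
              ← Polynomial.smul_eq_C_mul, map_smul, smul_apply, smul_smul,
              inv_mul_cancel₀ hCC, one_smul]
            simp
          rw [map_add, hCx, mul_assoc, ← Polynomial.smul_eq_C_mul, map_smul,
            smul_apply, hcomm]
          abel
        change ‖aeval T (Polynomial.C (C : ℂ) * (1 + q * X) * X ^ n) (w + x) - e j m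
            - aeval T q (T (e j m))‖ < _
        rw [key, norm_smul, Complex.norm_real, Real.norm_of_nonneg hC0.le]
        have := hiso n (1 + q * X)
        rw [hwq] at this ⊢
        calc C * _ ≤ C * ‖w + aeval T q (T w)‖ := by gcongr
          _ < C * (1 / ((N : ℝ) + 1) / C) := by gcongr
          _ = _ := by field_simp
  have : CompleteSpace W := Submodule.topologicalClosure.completeSpace _
  obtain ⟨u, hu⟩ := (dense_iInter_of_isOpen hO hD).nonempty
  set K := (Submodule.span ℂ (Set.range fun n : ℕ => (T ^ n) (w + u))).topologicalClosure with hK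
  have hKc : IsClosed (K : Set H) := Submodule.isClosed_topologicalClosure _
  have hYK : ∀ m, Y m ≤ K := by
    intro m
    induction m with
    | zero => simp [hY]
    | succ m ih =>
      refine Submodule.span_le.2 ?_
      rintro _ ⟨j, i, hi, rfl⟩
      rcases Nat.lt_succ_iff_lt_or_eq.1 hi with hi | rfl
      · exact ih (Submodule.subset_span ⟨j, i, hi, rfl⟩)
      · rw [← hKc.closure_eq, Metric.mem_closure_iff]
        intro ε hε
        obtain ⟨N, hN⟩ := exists_nat_one_div_lt hε
        have := Set.mem_iInter.1 hu (j, i, N)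
        simp only [O, Set.mem_iUnion, Set.mem_ofPred_eq] at this
        obtain ⟨q, y, hy, hq⟩ := this
        refine ⟨aeval T q (w + u) - y, K.sub_mem (aeval_mem_closure_span_orbit T _ q) (ih hy), ?_⟩
        rw [dist_comm, dist_eq_norm, sub_right_comm]
        exact hq.trans hN
  have heK : ∀ j m, e j m ∈ K := fun j m =>
    hYK (m + 1) (Submodule.subset_span ⟨j, m, m.lt_succ_self, rfl⟩)
  have hWK : W ≤ K := by
    refine Submodule.topologicalClosure_minimal _ (Submodule.span_le.2 ?_) hKc
    rintro _ ⟨p, rfl⟩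
    exact heK _ _
  refine ⟨w + u, ?_, heK⟩
  have hf : w + u ∈ K := by
    have := aeval_mem_closure_span_orbit T (w + u) 1
    rwa [map_one] at this
  have := K.sub_mem hf (hWK u.2)
  rwa [add_sub_cancel_right] at this

end BackwardShift

section Circle
open MeasureTheory AddCircle
open scoped NNReal

theorem integral_comp_fourier_neg_one_mul {A : ℂ → ℂ} {R : ℝ≥0} (hR : 1 < R)
    (hA : DifferentiableOn ℂ A (Metric.closedBall 0 R)) {G : UnitAddCircle → ℂ}
    (hG : Integrable G haarAddCircle)
    (h : ∀ n : ℕ, ∫ t, fourier (-((n : ℤ) + 1)) t * G t ∂haarAddCircle = 0) :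
    ∫ t, A (fourier (-1) t) * G t ∂haarAddCircle = A 0 * ∫ t, G t ∂haarAddCircle := by
  have hp := hA.hasFPowerSeriesOnBall (zero_lt_one.trans hR)
  set p := cauchyPowerSeries A 0 R
  have hrad : ((1 : ℝ≥0) : ENNReal) < p.radius :=
    lt_of_lt_of_le (by exact_mod_cast hR) hp.r_le
  have hsum : Summable fun n => ‖p.coeff n‖ := by
    simpa using p.summable_norm_mul_pow hrad
  have hnorm : ∀ (n : ℤ) (t : UnitAddCircle), ‖fourier n t‖ = 1 := fun n t => by
    rw [fourier_apply]; exact Circle.norm_coe _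
  have hpow : ∀ (n : ℕ) (t : UnitAddCircle), fourier (-1) t ^ n = fourier (-(n : ℤ)) t := by
    intro n t
    induction n with
    | zero => simp
    | succ n ih => rw [pow_succ, ih, ← fourier_add]; congr 2; push_cast; ring
  have hint : ∀ n : ℤ, Integrable (fun t => fourier n t * G t) haarAddCircle := fun n =>
    hG.bdd_mul (c := 1) (fourier n).continuous.aestronglyMeasurable
      (Eventually.of_forall fun t => (hnorm n t).le)
  have hF := hasSum_integral_of_summable_integral_norm
    (F := fun (n : ℕ) t => p.coeff n * (fourier (-(n : ℤ)) t * G t)) (μ := haarAddCircle)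
    (fun n => (hint _).const_mul _) (by
      simp only [norm_mul, hnorm, one_mul, integral_const_mul]
      exact hsum.mul_right _)
  have hval : ∀ t : UnitAddCircle, ∑' n : ℕ, p.coeff n * (fourier (-(n : ℤ)) t * G t) =
      A (fourier (-1) t) * G t := by
    intro t
    have ht : fourier (-1) t ∈ Metric.eball (0 : ℂ) R := by
      rw [Metric.mem_eball, edist_zero_right, ← ofReal_norm, hnorm]
      simpa using hR
    have := (hp.hasSum ht).mul_right (G t)
    simp only [FormalMultilinearSeries.apply_eq_pow_smul_coeff, zero_add, hpow, smul_eq_mul]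
      at this
    rw [← this.tsum_eq]
    exact tsum_congr fun n => by ring
  simp only [hval] at hF
  refine hF.unique ?_
  have h0 : p.coeff 0 = A 0 := hp.coeff_zero _
  convert! hasSum_single (α := ℂ) 0 ?_ using 1
  · simp [h0, integral_const_mul]
  · intro n hn
    obtain ⟨n, rfl⟩ := Nat.exists_eq_succ_of_ne_zero hn
    rw [integral_const_mul]
    have := h n
    push_cast
    rw [this, mul_zero]

theorem norm_one_sub_le_two_mul {z : ℂ} (hz : ‖z‖ = 1) {r : ℝ} (h0 : 0 ≤ r) (h1 : r ≤ 1) :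
    ‖1 - z‖ ≤ 2 * ‖1 - r * z‖ := by
  have h2 : ‖(r : ℂ) * z‖ = r := by simp [hz, abs_of_nonneg h0]
  have h3 : 1 - r ≤ ‖1 - r * z‖ := by
    have := norm_sub_norm_le 1 ((r : ℂ) * z)
    rwa [h2, norm_one] at this
  have h4 : ‖r * z - z‖ = 1 - r := by
    have : (r : ℂ) * z - z = ((r - 1 : ℝ) : ℂ) * z := by push_cast; ring
    rw [this, norm_mul, hz, mul_one, Complex.norm_real, Real.norm_eq_abs,
      abs_sub_comm, abs_of_nonneg (by linarith)]
  have : (1 : ℂ) - z = (1 - r * z) + (r * z - z) := by ring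
  rw [this]
  linarith [norm_add_le (1 - r * z) (r * z - z)]

theorem norm_exp_mul_le {z : ℂ} (hz : ‖z‖ = 1) {r s : ℝ} (h0 : 0 ≤ r) (h1 : r ≤ 1) (hs : 0 ≤ s) :
    ‖Complex.exp (s * ((1 + r * z) / (1 - r * z)))‖ * expNegInvGlue (‖1 - z‖ ^ 2) ≤
      Real.exp (4 * s ^ 2) := by
  rcases (norm_nonneg (1 - z)).eq_or_lt with hd | hd
  · rw [← hd]
    simpa [expNegInvGlue.zero] using (Real.exp_pos (4 * s ^ 2)).le
  have hd' := norm_one_sub_le_two_mul hz h0 h1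
  have hz' : 0 < ‖1 - r * z‖ := by linarith
  set d := ‖1 - z‖
  have hnum : ‖1 + r * z‖ ≤ 2 := by
    refine (norm_add_le _ _).trans ?_
    simp [hz, abs_of_nonneg h0]; linarith
  have hb : ‖(s : ℂ) * ((1 + r * z) / (1 - r * z))‖ ≤ 4 * s * d⁻¹ := by
    rw [norm_mul, norm_div, Complex.norm_real, Real.norm_of_nonneg hs]
    calc s * (‖1 + r * z‖ / ‖1 - r * z‖) ≤ s * (2 / (d / 2)) := by
          gcongr; linarith
      _ = _ := by field_simp; norm_num
  have hg : expNegInvGlue (d ^ 2) = Real.exp (-(d ^ 2)⁻¹) := by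
    rw [expNegInvGlue, if_neg (by positivity : 0 < d ^ 2).not_ge]
  rw [hg]
  calc _ ≤ Real.exp (4 * s * d⁻¹) * Real.exp (-(d ^ 2)⁻¹) := by
        gcongr
        exact (Complex.norm_exp_le_exp_norm _).trans (Real.exp_le_exp.2 hb)
    _ ≤ _ := by
        rw [← Real.exp_add, Real.exp_le_exp, ← inv_pow]
        nlinarith [sq_nonneg (2 * s - d⁻¹)]

theorem norm_exp_mul_cayley {z : ℂ} (hz : ‖z‖ = 1) (s : ℝ) :
    ‖Complex.exp (s * ((1 + z) / (1 - z)))‖ = 1 := by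
  have hzz : z.re * z.re + z.im * z.im = 1 := by
    rw [← Complex.normSq_apply, Complex.normSq_eq_norm_sq, hz, one_pow]
  rw [Complex.norm_exp, Real.exp_eq_one_iff, Complex.re_ofReal_mul, Complex.div_re]
  simp only [Complex.add_re, Complex.one_re, Complex.sub_re, Complex.add_im, Complex.one_im,
    Complex.sub_im]
  rw [← add_div, show (1 + z.re) * (1 - z.re) + (0 + z.im) * (0 - z.im) = 0 by linarith]
  simp

/-- A function whose Fourier coefficients of one sign vanish and which is dominated by
`exp (-1 / d²)`, `d` the distance to `1`, has mean zero: integrate it against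
`exp (s (1 + r z) / (1 - r z))`, let `r → 1`, then `s → ∞`. -/
theorem integral_eq_zero_of_flat {G B : UnitAddCircle → ℂ}
    (hB : Integrable B haarAddCircle)
    (hGB : ∀ t, G t = expNegInvGlue (‖1 - fourier (-1) t‖ ^ 2) * B t)
    (h : ∀ n : ℕ, ∫ t, fourier (-((n : ℤ) + 1)) t * G t ∂haarAddCircle = 0) :
    ∫ t, G t ∂haarAddCircle = 0 := by
  have hz : ∀ t : UnitAddCircle, ‖fourier (-1) t‖ = 1 := fun t => by
    rw [fourier_apply]; exact Circle.norm_coe _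
  have hcont : Continuous fun t : UnitAddCircle => fourier (-1) t := (fourier (-1)).continuous
  have hglue : Continuous expNegInvGlue := (expNegInvGlue.contDiff (n := 0)).continuous
  have hGmeas : AEStronglyMeasurable G haarAddCircle := by
    rw [funext hGB]
    exact (Continuous.aestronglyMeasurable (by fun_prop)).mul hB.aestronglyMeasurable
  have hG : Integrable G haarAddCircle := by
    refine hB.mono hGmeas (Eventually.of_forall fun t => ?_)
    rw [hGB, norm_mul, Complex.norm_real, Real.norm_of_nonneg (expNegInvGlue.nonneg _)]
    have := norm_exp_mul_le (hz t) (r := 0) (s := 0) le_rfl zero_le_one le_rfl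
    exact mul_le_of_le_one_left (norm_nonneg _) (by simpa using this)
  have hbound : ∀ s : ℕ, Real.exp s * ‖∫ t, G t ∂haarAddCircle‖ ≤ ∫ t, ‖G t‖ ∂haarAddCircle := by
    intro s
    obtain ⟨r, -, hr, hr1⟩ := exists_seq_strictMono_tendsto' (show (0 : ℝ) < 1 by norm_num)
    let A : ℝ → ℂ → ℂ := fun ρ z => Complex.exp ((s : ℝ) * ((1 + ρ * z) / (1 - ρ * z)))
    have hrep : ∀ n, ∫ t, A (r n) (fourier (-1) t) * G t ∂haarAddCircle
        = Complex.exp s * ∫ t, G t ∂haarAddCircle := by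
      intro n
      have h0 := (hr n).1
      have h1 := (hr n).2
      obtain ⟨R, hR1, hR2⟩ := exists_between ((one_lt_inv₀ h0).2 h1)
      lift R to ℝ≥0 using (zero_le_one.trans hR1.le)
      have hA0 : A (r n) 0 = Complex.exp s := by simp [A]
      rw [← hA0]
      refine integral_comp_fourier_neg_one_mul (R := R) (by exact_mod_cast hR1) ?_ hG h
      intro z hzR
      have hne : (1 : ℂ) - r n * z ≠ 0 := by
        intro h
        have h3 : ‖(r n : ℂ) * z‖ = 1 := by rw [← sub_eq_zero.1 h, norm_one]
        rw [norm_mul, Complex.norm_real, Real.norm_of_nonneg h0.le] at h3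
        have h4 : ‖z‖ ≤ R := by simpa using hzR
        have h5 : r n * R < 1 := by
          rwa [lt_inv_comm₀ (by positivity) h0, lt_inv_comm₀ h0 (by positivity), ← one_div,
            lt_div_iff₀ h0, mul_comm] at hR2
        nlinarith
      refine DifferentiableAt.differentiableWithinAt ?_
      fun_prop (disch := exact hne)
    have hlim := tendsto_integral_of_dominated_convergence
      (F := fun n t => A (r n) (fourier (-1) t) * G t)
      (f := fun t => A 1 (fourier (-1) t) * G t) (μ := haarAddCircle)
      (fun t => Real.exp (4 * (s : ℝ) ^ 2) * ‖B t‖) ?_ (hB.norm.const_mul _) ?_ ?_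
    · simp only [hrep] at hlim
      have heq := tendsto_nhds_unique hlim tendsto_const_nhds
      have hn := congrArg norm heq
      rw [norm_mul, Complex.norm_exp, Complex.natCast_re] at hn
      rw [← hn]
      refine (norm_integral_le_integral_norm _).trans_eq ?_
      refine integral_congr_ae (Eventually.of_forall fun t => ?_)
      have := norm_exp_mul_cayley (hz t) s
      simp only [norm_mul, A, Complex.ofReal_one, one_mul, this]
    · intro n
      refine Measurable.aestronglyMeasurable (by fun_prop) |>.mul hGmeas
    · refine fun n => Eventually.of_forall fun t => ?_
      have := norm_exp_mul_le (hz t) (r := r n) (s := s) (hr n).1.le (hr n).2.le (by positivity)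
      rw [hGB, ← mul_assoc, norm_mul, norm_mul, Complex.norm_real,
        Real.norm_of_nonneg (expNegInvGlue.nonneg _)]
      gcongr
    · refine Eventually.of_forall fun t => ?_
      by_cases h1 : (1 : ℂ) - fourier (-1) t = 0
      · have : G t = 0 := by rw [hGB, h1]; simp
        simp [this]
      · refine Tendsto.mul_const _ ?_
        have hc : ContinuousAt (fun ρ : ℝ => A ρ (fourier (-1) t)) 1 := by
          have : (1 : ℂ) - ((1 : ℝ) : ℂ) * fourier (-1) t ≠ 0 := by simpa using h1
          fun_prop (disch := exact this)
        exact hc.tendsto.comp hr1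
  by_contra hne
  have hpos : 0 < ‖∫ t, G t ∂haarAddCircle‖ := norm_pos_iff.2 hne
  obtain ⟨s, hs⟩ := exists_nat_gt ((∫ t, ‖G t‖ ∂haarAddCircle) / ‖∫ t, G t ∂haarAddCircle‖)
  rw [div_lt_iff₀ hpos] at hs
  have := Real.add_one_le_exp (s : ℝ)
  nlinarith [hbound s]


/-- There is a continuous function on the circle whose translates by the bilateral shift in one
direction span a dense subspace of `L²`. -/
theorem exists_dense_span_fourier_mul :
    ∃ φ : C(UnitAddCircle, ℂ), (Submodule.span ℂ (Set.range fun n : ℕ =>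
      ContinuousMap.toLp (E := ℂ) 2 haarAddCircle ℂ (fourier n * φ))).topologicalClosure = ⊤ := by
  have hglue : Continuous expNegInvGlue := (expNegInvGlue.contDiff (n := 0)).continuous
  let φ : C(UnitAddCircle, ℂ) :=
    ⟨fun t => expNegInvGlue (‖1 - fourier (-1) t‖ ^ 2), by fun_prop⟩
  refine ⟨φ, ?_⟩
  rw [Submodule.topologicalClosure_eq_top_iff, Submodule.eq_bot_iff]
  intro ψ hψ
  have hψL : MemLp ψ 2 haarAddCircle := Lp.memLp ψ
  have hψI : Integrable ψ haarAddCircle := hψL.integrable one_le_two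
  have hnorm : ∀ (n : ℤ) (t : UnitAddCircle), ‖fourier n t‖ = 1 := fun n t => by
    rw [fourier_apply]; exact Circle.norm_coe _
  have hneg : ∀ n : ℕ, ∫ t, fourier (-(n : ℤ)) t * (φ t * ψ t) ∂haarAddCircle = 0 := by
    intro n
    have hin := (Submodule.mem_orthogonal _ _).1 hψ _ (Submodule.subset_span ⟨n, rfl⟩)
    rw [L2.inner_def] at hin
    rw [← hin]
    refine integral_congr_ae ?_
    filter_upwards [ContinuousMap.coeFn_toLp (p := 2) (𝕜 := ℂ) haarAddCircle (fourier n * φ)]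
      with t ht
    rw [ht, RCLike.inner_apply, ContinuousMap.mul_apply, map_mul, fourier_neg,
      show (starRingEnd ℂ) (φ t) = φ t from Complex.conj_ofReal _]
    ring
  have hall : ∀ n : ℕ, ∀ m : ℤ, m ≤ n → ∫ t, fourier m t * (φ t * ψ t) ∂haarAddCircle = 0 := by
    intro n
    induction n with
    | zero =>
      intro m hm
      have := hneg m.natAbs
      rwa [show -(m.natAbs : ℤ) = m by omega] at this
    | succ n ih =>
      intro m hm
      rcases hm.lt_or_eq with hm | rfl
      · exact ih m (by push_cast at hm; omega)
      · refine integral_eq_zero_of_flat (B := fun t => fourier ((n + 1 : ℕ) : ℤ) t * ψ t) ?_ ?_ ?_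
        · exact hψI.bdd_mul (c := 1) (fourier _).continuous.aestronglyMeasurable
            (Eventually.of_forall fun t => (hnorm _ t).le)
        · intro t
          change fourier ((n + 1 : ℕ) : ℤ) t * (φ t * ψ t) = φ t * _
          ring
        · intro k
          rw [← ih (-((k : ℤ) + 1) + (n + 1 : ℕ)) (by push_cast; omega)]
          simp only [fourier_add, mul_assoc]
  have hF : MemLp (fun t => φ t * ψ t) 2 haarAddCircle := by
    refine hψL.of_le_mul (c := ‖φ‖)
      (φ.continuous.aestronglyMeasurable.mul hψL.aestronglyMeasurable)
      (Eventually.of_forall fun t => ?_)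
    rw [norm_mul]
    gcongr
    exact φ.norm_coe_le_norm t
  have hF0 : hF.toLp _ = 0 := by
    apply fourierBasis.repr.injective
    rw [map_zero]
    ext n
    rw [fourierBasis_repr, fourierCoeff_congr_ae hF.coeFn_toLp]
    exact hall (-n).natAbs _ Int.le_natAbs
  have hφψ : (fun t => φ t * ψ t) =ᵐ[haarAddCircle] 0 := by
    have := hF.coeFn_toLp
    rw [hF0] at this
    exact this.symm.trans (Lp.coeFn_zero _ _ _)
  have hatom : ∀ᵐ t ∂(haarAddCircle : Measure UnitAddCircle), t ≠ 0 := by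
    have h := volume_closedBall 1 (x := (0 : UnitAddCircle)) 0
    rw [Metric.closedBall_zero, volume_eq_smul_haarAddCircle] at h
    rw [ae_iff]
    simpa using h
  rw [Lp.eq_zero_iff_ae_eq_zero]
  filter_upwards [hφψ, hatom] with t ht ht0
  refine (mul_eq_zero.1 ht).resolve_left fun h => ?_
  have h1 : expNegInvGlue (‖1 - fourier (-1) t‖ ^ 2) = 0 := Complex.ofReal_eq_zero.1 h
  rw [expNegInvGlue.zero_iff_nonpos] at h1
  have h2 : (1 : ℂ) - fourier (-1) t = 0 := by
    rw [← norm_eq_zero]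
    nlinarith [norm_nonneg ((1 : ℂ) - fourier (-1) t)]
  apply ht0
  have h3 : toCircle ((-1 : ℤ) • t) = 1 := Circle.ext (by
    rw [← fourier_apply, ← sub_eq_zero.1 h2, Circle.coe_one])
  have h4 := injective_toCircle one_ne_zero (h3.trans toCircle_zero.symm)
  simpa using h4

end Circle

open AddCircle in
theorem pow_apply_fourier_mul {H : Type*} [NormedAddCommGroup H] [NormedSpace ℂ H]
    {T : H →L[ℂ] H} {Φ : C(UnitAddCircle, ℂ) →L[ℂ] H}
    (hΦ : ∀ n : ℤ, T (Φ (fourier n)) = Φ (fourier (n + 1))) (g : C(UnitAddCircle, ℂ)) (n : ℕ) :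
    (T ^ n) (Φ g) = Φ (fourier n * g) := by
  have hone : ∀ g, T (Φ g) = Φ (fourier 1 * g) := by
    have : T.comp Φ = Φ.comp (ContinuousLinearMap.mul ℂ C(UnitAddCircle, ℂ) (fourier 1)) := by
      refine ContinuousLinearMap.ext_on
        (Submodule.dense_iff_topologicalClosure_eq_top.2 span_fourier_closure_eq_top) ?_
      rintro _ ⟨n, rfl⟩
      have hmul : (fourier 1 : C(UnitAddCircle, ℂ)) * fourier n = fourier (n + 1) := by
        ext t
        rw [ContinuousMap.mul_apply, fourier_add, mul_comm]
      rw [ContinuousLinearMap.comp_apply, ContinuousLinearMap.comp_apply, hΦ,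
        ContinuousLinearMap.mul_apply', hmul]
    exact fun g => DFunLike.congr_fun this g
  induction n with
  | zero =>
    have : (fourier ((0 : ℕ) : ℤ) : C(UnitAddCircle, ℂ)) * g = g := by
      ext t
      simp
    rw [this]
    simp
  | succ n ih =>
    rw [pow_succ', mul_apply_eq_comp, ih, hone]
    congr 1
    ext t
    simp only [ContinuousMap.mul_apply, Nat.cast_succ, fourier_add]
    ring

section BilateralShift

variable {H : Type*} [NormedAddCommGroup H] [InnerProductSpace ℂ H] [CompleteSpace H]

theorem exists_linearIsometry_lp_of_orthonormal {ι : Type*} [DecidableEq ι] {v : ι → H}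
    (hv : Orthonormal ℂ v) :
    ∃ V : lp (fun _ : ι => ℂ) 2 →ₗᵢ[ℂ] H, (∀ i, V (lp.single 2 i 1) = v i) ∧
      LinearMap.range V.toLinearMap = (Submodule.span ℂ (Set.range v)).topologicalClosure := by
  refine ⟨hv.orthogonalFamily.linearIsometry, fun i => ?_, ?_⟩
  · rw [OrthogonalFamily.linearIsometry_apply_single]
    simp
  · rw [OrthogonalFamily.range_linearIsometry, Submodule.span_range_eq_iSup]
    congr! 3 with i
    exact LinearMap.range_toSpanSingleton _

variable {T : H →L[ℂ] H} {v : ℤ → H}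

theorem norm_map_and_surjOn_of_bilateral (hv : Orthonormal ℂ v) (hT : ∀ n, T (v n) = v (n + 1)) :
    (∀ x ∈ (Submodule.span ℂ (Set.range v)).topologicalClosure,
      T x ∈ (Submodule.span ℂ (Set.range v)).topologicalClosure ∧ ‖T x‖ = ‖x‖) ∧
    ∀ x ∈ (Submodule.span ℂ (Set.range v)).topologicalClosure,
      ∃ y ∈ (Submodule.span ℂ (Set.range v)).topologicalClosure, T y = x := by
  obtain ⟨V, hV, hVr⟩ := exists_linearIsometry_lp_of_orthonormal hv
  obtain ⟨V', hV', hVr'⟩ := exists_linearIsometry_lp_of_orthonormal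
    (hv.comp (fun n : ℤ => n + 1) (add_left_injective 1))
  have hrange : Set.range (v ∘ fun n : ℤ => n + 1) = Set.range v :=
    (Equiv.addRight (1 : ℤ)).surjective.range_comp v
  rw [hrange] at hVr'
  have hTV : ∀ x, T (V x) = V' x := by
    have : T.comp V.toContinuousLinearMap = V'.toContinuousLinearMap := by
      refine lp.ext_continuousLinearMap (by simp) fun n => ?_
      ext
      simp [hV, hV', hT]
    exact fun x => DFunLike.congr_fun this x
  constructor
  · intro x hx
    rw [← hVr] at hx
    obtain ⟨x, rfl⟩ := hx
    rw [LinearIsometry.coe_toLinearMap, hTV, ← hVr', V'.norm_map, V.norm_map]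
    exact ⟨⟨x, rfl⟩, rfl⟩
  · intro x hx
    rw [← hVr'] at hx
    obtain ⟨x, rfl⟩ := hx
    exact ⟨V x, hVr ▸ ⟨x, rfl⟩, hTV x⟩

open MeasureTheory AddCircle in
theorem exists_closure_span_orbit_bilateral (hv : Orthonormal ℂ v)
    (hT : ∀ n, T (v n) = v (n + 1)) :
    ∃ w, (Submodule.span ℂ (Set.range fun n : ℕ => (T ^ n) w)).topologicalClosure =
      (Submodule.span ℂ (Set.range v)).topologicalClosure := by
  obtain ⟨φ, hφ⟩ := exists_dense_span_fourier_mul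
  obtain ⟨V, hV, hVr⟩ := exists_linearIsometry_lp_of_orthonormal hv
  let U : Lp ℂ 2 (haarAddCircle : Measure UnitAddCircle) →ₗᵢ[ℂ] H :=
    V.comp fourierBasis.repr.toLinearIsometry
  let L : C(UnitAddCircle, ℂ) →L[ℂ] Lp ℂ 2 (haarAddCircle : Measure UnitAddCircle) :=
    ContinuousMap.toLp (E := ℂ) 2 haarAddCircle ℂ
  have hUr : LinearMap.range U.toLinearMap =
      (Submodule.span ℂ (Set.range v)).topologicalClosure := by
    rw [← hVr]
    exact LinearMap.range_comp_of_range_eq_top _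
      (LinearMap.range_eq_top.2 fourierBasis.repr.surjective)
  have hUL : ∀ n, U (L (fourier n)) = v n := by
    intro n
    have : L (fourier n) = fourierBasis n := by rw [coe_fourierBasis]
    change V (fourierBasis.repr _) = _
    rw [this, HilbertBasis.repr_self, hV]
  have hpow : ∀ n : ℕ, (T ^ n) (U (L φ)) = U (L (fourier n * φ)) :=
    pow_apply_fourier_mul (Φ := U.toContinuousLinearMap.comp L)
      (fun n => (congrArg T (hUL n)).trans ((hT n).trans (hUL (n + 1)).symm)) φ
  refine ⟨U (L φ), ?_⟩
  simp only [hpow]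
  rw [← hUr]
  have hmap := U.isometry.isClosedEmbedding.closure_image_eq
    (Submodule.span ℂ (Set.range fun n : ℕ => L (fourier n * φ)) : Set (Lp ℂ 2 haarAddCircle))
  apply SetLike.coe_injective
  have himg : (Submodule.span ℂ (Set.range fun n : ℕ => U (L (fourier n * φ))) : Set H) =
      U '' (Submodule.span ℂ (Set.range fun n : ℕ => L (fourier n * φ))) := by
    rw [Set.range_comp' U, ← U.coe_toLinearMap, ← Submodule.map_span, Submodule.map_coe]
  rw [Submodule.topologicalClosure_coe, himg, hmap, ← Submodule.topologicalClosure_coe, hφ]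
  rw [Submodule.top_coe, Set.image_univ]
  exact (LinearMap.coe_range _).symm

end BilateralShift

/-- For every `k ≥ 1`, the operator `S ⊕ (S⁺_k)*` — the orthogonal direct sum of the simple
bilateral shift and `k` copies of the simple backward unilateral shift, realized on
`ℓ²(ℤ ⊕ (Fin k × ℤ₊))` — is cyclic. -/
theorem stmt_18 (k : ℕ) (hk : 1 ≤ k)
    (T : lp (fun _ : ℤ ⊕ (Fin k × ℕ) => ℂ) 2 →L[ℂ] lp (fun _ : ℤ ⊕ (Fin k × ℕ) => ℂ) 2)
    (hTbil : ∀ n : ℤ, T (lp.single 2 (Sum.inl n) (1 : ℂ)) =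
      lp.single 2 (Sum.inl (n + 1)) (1 : ℂ))
    (hTzero : ∀ j : Fin k, T (lp.single 2 (Sum.inr (j, 0)) (1 : ℂ)) = 0)
    (hTback : ∀ (j : Fin k) (m : ℕ), T (lp.single 2 (Sum.inr (j, m + 1)) (1 : ℂ)) =
      lp.single 2 (Sum.inr (j, m)) (1 : ℂ)) :
    ∃ f, IsCyclicVector T f := by
  let b : HilbertBasis (ℤ ⊕ (Fin k × ℕ)) ℂ (lp (fun _ : ℤ ⊕ (Fin k × ℕ) => ℂ) 2) :=
    ⟨LinearIsometryEquiv.refl ℂ _⟩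
  have hb : ∀ i, b i = lp.single 2 i (1 : ℂ) := fun i => by
    rw [← b.repr_symm_single]
    rfl
  simp only [← hb] at hTbil hTzero hTback
  have hv : Orthonormal ℂ fun n : ℤ => b (Sum.inl n) := b.orthonormal.comp _ Sum.inl_injective
  obtain ⟨hmap, hsurj⟩ := norm_map_and_surjOn_of_bilateral hv hTbil
  obtain ⟨w, hw⟩ := exists_closure_span_orbit_bilateral hv hTbil
  set R := (Submodule.span ℂ (Set.range fun n : ℤ => b (Sum.inl n))).topologicalClosure
  have hq : ∀ q : Polynomial ℂ, Polynomial.aeval T q w ∈ R := fun q =>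
    hw ▸ aeval_mem_closure_span_orbit T w q
  have hwR : w ∈ R := by
    have := hq 1
    rwa [map_one] at this
  have hiso : ∀ n : ℕ, ∀ x ∈ R, (T ^ n) x ∈ R ∧ ‖(T ^ n) x‖ = ‖x‖ := by
    intro n x hx
    induction n with
    | zero => simpa using hx
    | succ n ih =>
      rw [pow_succ', mul_apply_eq_comp]
      exact ⟨(hmap _ ih.1).1, (hmap _ ih.1).2.trans ih.2⟩
  have hlim : ∀ ε > 0, ∃ q : Polynomial ℂ, ‖w + Polynomial.aeval T q (T w)‖ < ε := by
    intro ε hε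
    obtain ⟨y, hy, hyw⟩ := hsurj w hwR
    rw [← hw] at hy
    obtain ⟨z, hz, hyz⟩ := Metric.mem_closure_iff.1 hy ε hε
    obtain ⟨q, rfl⟩ := exists_aeval_of_mem_span_orbit T hz
    refine ⟨-q, ?_⟩
    have hcomm : w + Polynomial.aeval T (-q) (T w) = T (y - Polynomial.aeval T q w) := by
      have : Polynomial.aeval T q (T w) = T (Polynomial.aeval T q w) := by
        have := congrArg (fun p => Polynomial.aeval T p w) (mul_comm q Polynomial.X)
        simpa only [map_mul, Polynomial.aeval_X, mul_apply_eq_comp] using this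
      rw [map_neg, neg_apply, this, map_sub, hyw, sub_eq_add_neg]
    rw [hcomm, (hmap _ (R.sub_mem (hw ▸ hy) (hq q))).2, ← dist_eq_norm]
    exact hyz
  obtain ⟨f, hfw, hfe⟩ := exists_closure_span_orbit_backward
    (e := fun (j : Fin k) m => b (Sum.inr (j, m))) hTzero hTback
    (fun j m => (b.orthonormal.1 _).le) w hlim (fun n q => (hiso n _ (hq q)).2.le)
  refine ⟨f, ?_⟩
  set K := (Submodule.span ℂ (Set.range fun n : ℕ => (T ^ n) f)).topologicalClosure with hK
  have hKc : IsClosed (K : Set (lp (fun _ : ℤ ⊕ (Fin k × ℕ) => ℂ) 2)) :=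
    Submodule.isClosed_topologicalClosure _
  have hTw : ∀ n : ℕ, (T ^ n) w ∈ K := by
    intro n
    induction n with
    | zero => simpa using hfw
    | succ n ih =>
      rw [pow_succ', mul_apply_eq_comp]
      exact map_mem_closure_span_orbit T ih
  have hRK : R ≤ K := by
    rw [← hw]
    exact Submodule.topologicalClosure_minimal _
      (Submodule.span_le.2 (Set.range_subset_iff.2 hTw)) hKc
  change K = ⊤
  rw [eq_top_iff, ← b.dense_span]
  refine Submodule.topologicalClosure_minimal _ (Submodule.span_le.2 ?_) hKc
  rintro _ ⟨n | ⟨j, m⟩, rfl⟩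
  · exact hRK (Submodule.le_topologicalClosure _ (Submodule.subset_span ⟨n, rfl⟩))
  · exact hfe j m
end
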